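/- If A is a formula of L_{∧,◇,♦}, then the schematic labeled sequent φ_ẇ(A) forms a polytree: its graph, whose vertices are the label variables occurring in φ_ẇ(A) and whose edges (ẇ,u̇) are given by the schematic relational atoms Rẇu̇ occurring in it, is connected and free of directed and undirected cycles. -/

import Mathlib

set_option linter.unusedVariables false

/-- Formulae of the tense language `L`. -/
inductive Fm : Type where
  | atom : Nat → Fm
  | top : Fm
  | bot : Fm
  | neg : Fm → Fm
  | or : Fm → Fm → Fm
  | and : Fm → Fm → Fm
  | imp : Fm → Fm → Fm
  | box : Fm → Fm
  | dia : Fm → Fm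
  | boxP : Fm → Fm
  | diaP : Fm → Fm
deriving DecidableEq

instance : Inhabited Fm := ⟨Fm.top⟩

/-- The language `L_{∧,◇,♦}`. -/
inductive SimpFm : Fm → Prop where
  | atom (p : Nat) : SimpFm (.atom p)
  | top : SimpFm .top
  | and {A B : Fm} : SimpFm A → SimpFm B → SimpFm (.and A B)
  | dia {A : Fm} : SimpFm A → SimpFm (.dia A)
  | diaP {A : Fm} : SimpFm A → SimpFm (.diaP A)

/-- The grammar `A ::= p | ⊤ | (A∧A) | (A∨A) | ◇A | ♦A` of primitive tense axioms. -/
inductive PrimFm : Fm → Prop where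
  | atom (p : Nat) : PrimFm (.atom p)
  | top : PrimFm .top
  | and {A B : Fm} : PrimFm A → PrimFm B → PrimFm (.and A B)
  | or {A B : Fm} : PrimFm A → PrimFm B → PrimFm (.or A B)
  | dia {A : Fm} : PrimFm A → PrimFm (.dia A)
  | diaP {A : Fm} : PrimFm A → PrimFm (.diaP A)

/-- Number of occurrences of the atom `p` in a formula. -/
def atomCount : Fm → Nat → Nat
  | .atom q, p => if q = p then 1 else 0
  | .top, _ => 0
  | .bot, _ => 0
  | .neg A, p => atomCount A p
  | .or A B, p => atomCount A p + atomCount B p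
  | .and A B, p => atomCount A p + atomCount B p
  | .imp A B, p => atomCount A p + atomCount B p
  | .box A, p => atomCount A p
  | .dia A, p => atomCount A p
  | .boxP A, p => atomCount A p
  | .diaP A, p => atomCount A p

/-- `A` contains each propositional atom at most once. -/
def AtomsOnce (A : Fm) : Prop := ∀ p, atomCount A p ≤ 1

/-- A simplified primitive tense axiom, encoded as its antecedent together with the
(nonempty) list of its disjuncts. -/
def ValidAx (x : Fm × List Fm) : Prop :=
  SimpFm x.1 ∧ AtomsOnce x.1 ∧ x.2 ≠ [] ∧ ∀ B ∈ x.2, SimpFm B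

/-- A set of simplified primitive tense axioms. -/
def ValidAxSet (P : Set (Fm × List Fm)) : Prop := ∀ x ∈ P, ValidAx x

/-- A schematic labeled sequent produced by the translation `φ`: a list of schematic
relational atoms over label variables, together with a list of slots, one for each
labeled-sequent variable `Λ̇_p^ẇ` (recording the atom `p` and the label variable `ẇ`). -/
structure PhiShape : Type where
  rel : List (Nat × Nat)
  slots : List (Nat × Nat)

instance : Inhabited PhiShape := ⟨⟨[], []⟩⟩

/-- Composition of schematic labeled sequents. -/
def PhiShape.comp (s t : PhiShape) : PhiShape := ⟨s.rel ++ t.rel, s.slots ++ t.slots⟩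

/-- The label variables occurring in schematic relational atoms. -/
def PhiShape.relVars (s : PhiShape) : List Nat := s.rel.map Prod.fst ++ s.rel.map Prod.snd

/-- All label variables occurring in a schematic labeled sequent. -/
def PhiShape.vars (s : PhiShape) : List Nat := s.relVars ++ s.slots.map Prod.snd

/-- Renaming the label variables of a schematic labeled sequent. -/
def PhiShape.rename (ρ : Nat → Nat) (s : PhiShape) : PhiShape :=
  ⟨s.rel.map (fun e => (ρ e.1, ρ e.2)), s.slots.map (fun e => (e.1, ρ e.2))⟩

/-- The translation `φ_ẇ` on `L_{∧,◇,♦}`, with root label variable `w` and a counter `c`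
supplying new label variables: `φ_ẇ(⊤) = (∅⇒∅)`, `φ_ẇ(p) = Λ̇_p^ẇ`,
`φ_ẇ(A∧B) = φ_ẇ(A) ⊗ φ_ẇ(B)`, `φ_ẇ(◇A) = (Rẇu̇ ⇒ ∅) ⊗ φ_u̇(A)` and
`φ_ẇ(♦A) = (Ru̇ẇ ⇒ ∅) ⊗ φ_u̇(A)` with `u̇` a new label variable. -/
def phiAux : Fm → Nat → Nat → PhiShape × Nat
  | .atom p, w, c => (⟨[], [(p, w)]⟩, c)
  | .and A B, w, c =>
      let r := phiAux A w c
      let t := phiAux B w r.2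
      (r.1.comp t.1, t.2)
  | .dia A, w, c =>
      let r := phiAux A c (c + 1)
      (⟨(w, c) :: r.1.rel, r.1.slots⟩, r.2)
  | .diaP A, w, c =>
      let r := phiAux A c (c + 1)
      (⟨(c, w) :: r.1.rel, r.1.slots⟩, r.2)
  | _, _, c => (⟨[], []⟩, c)

/-- The graph of a schematic labeled sequent: label variables as vertices, with an edge
between `a` and `b` for each schematic relational atom `Rab`. -/
def shapeGraph (sh : PhiShape) : SimpleGraph Nat :=
  SimpleGraph.fromRel (fun a b => (a, b) ∈ sh.rel)

/-- The label variables occurring in a schematic labeled sequent, as a finite set. -/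
def shapeVars (sh : PhiShape) : Finset Nat := sh.vars.toFinset

/-- A graph on a linear order in which every vertex has at most one smaller neighbour
is acyclic. -/
theorem SimpleGraph.isAcyclic_of_unique_lt_adj {V : Type*} [LinearOrder V] {G : SimpleGraph V}
    (h : ∀ u x y, G.Adj u x → G.Adj u y → x < u → y < u → x = y) : G.IsAcyclic := by
  intro v p hp
  obtain ⟨u, hu, hmax⟩ := p.support.toFinset.exists_max_image id ⟨v, by simp⟩
  rw [List.mem_toFinset] at hu
  have hq := hp.rotate hu
  have hle : ∀ x ∈ (p.rotate u hu).support, x ≤ u := fun x hx =>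
    hmax x (List.mem_toFinset.2 ((SimpleGraph.Walk.mem_support_rotate_iff _ _ hu).1 hx))
  have hs := (p.rotate u hu).adj_snd hq.not_nil
  have hpen := ((p.rotate u hu).adj_penultimate hq.not_nil).symm
  exact hq.snd_ne_penultimate <| h u _ _ hs hpen
    (lt_of_le_of_ne (hle _ (SimpleGraph.Walk.getVert_mem_support _ _)) hs.ne')
    (lt_of_le_of_ne (hle _ (SimpleGraph.Walk.getVert_mem_support _ _)) hpen.ne')

theorem shapeGraph_adj {s : PhiShape} {a b : Nat} :
    (shapeGraph s).Adj a b ↔ a ≠ b ∧ ((a, b) ∈ s.rel ∨ (b, a) ∈ s.rel) :=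
  SimpleGraph.fromRel_adj _ _ _

theorem shapeGraph_mono {s t : PhiShape} (h : s.rel ⊆ t.rel) : shapeGraph s ≤ shapeGraph t := by
  intro a b hab
  rw [shapeGraph_adj] at hab ⊢
  exact ⟨hab.1, hab.2.imp (@h _) (@h _)⟩

theorem PhiShape.mem_vars {s : PhiShape} {x : Nat} :
    x ∈ s.vars ↔ (∃ y, (x, y) ∈ s.rel) ∨ (∃ y, (y, x) ∈ s.rel) ∨ ∃ p, (p, x) ∈ s.slots := by
  simp [PhiShape.vars, PhiShape.relVars]

/-- `s` is a tree rooted at `w` all of whose other vertices lie in `[c, d)`, each of them being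
the larger endpoint of exactly one edge. -/
structure PhiShape.IsIncreasingTree (s : PhiShape) (w c d : Nat) : Prop where
  le : c ≤ d
  ne : ∀ e ∈ s.rel, e.1 ≠ e.2
  bounds : ∀ e ∈ s.rel, c ≤ max e.1 e.2 ∧ max e.1 e.2 < d
  nodup : (s.rel.map fun e => max e.1 e.2).Nodup
  reachable : ∀ x ∈ s.vars, (shapeGraph s).Reachable w x

namespace PhiShape.IsIncreasingTree

variable {s t : PhiShape} {w c d d' : Nat}

theorem comp (hs : s.IsIncreasingTree w c d) (ht : t.IsIncreasingTree w d d') :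
    (s.comp t).IsIncreasingTree w c d' where
  le := hs.le.trans ht.le
  ne e he := (List.mem_append.1 he).elim (hs.ne e) (ht.ne e)
  bounds e he := by
    have h₁ := hs.le
    have h₂ := ht.le
    rcases List.mem_append.1 he with he | he
    · have := hs.bounds e he
      omega
    · have := ht.bounds e he
      omega
  nodup := by
    simp only [PhiShape.comp, List.map_append]
    refine hs.nodup.append ht.nodup fun m hm hm' => ?_
    obtain ⟨e, he, rfl⟩ := List.mem_map.1 hm
    obtain ⟨f, hf, hfe⟩ := List.mem_map.1 hm'
    have h₁ := hs.bounds e he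
    have h₂ := ht.bounds f hf
    omega
  reachable x hx := by
    have hx' : x ∈ s.vars ∨ x ∈ t.vars := by
      simp only [PhiShape.mem_vars, PhiShape.comp, List.mem_append, exists_or] at hx ⊢
      tauto
    rcases hx' with hx | hx
    · exact (hs.reachable x hx).mono (shapeGraph_mono (List.subset_append_left _ _))
    · exact (ht.reachable x hx).mono (shapeGraph_mono (List.subset_append_right _ _))

theorem cons (hs : s.IsIncreasingTree c (c + 1) d) (hwc : w < c) {e : Nat × Nat}
    (he : e = (w, c) ∨ e = (c, w)) :
    PhiShape.IsIncreasingTree ⟨e :: s.rel, s.slots⟩ w c d := by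
  have hle := hs.le
  have hmax : max e.1 e.2 = c := by rcases he with rfl | rfl <;> simp [hwc.le]
  have hadj : (shapeGraph ⟨e :: s.rel, s.slots⟩).Adj w c := by
    rw [shapeGraph_adj]
    refine ⟨hwc.ne, ?_⟩
    rcases he with rfl | rfl <;> simp
  refine ⟨by omega, ?_, ?_, ?_, ?_⟩
  · intro f hf
    rcases List.mem_cons.1 hf with rfl | hf
    · rcases he with rfl | rfl <;> simp [hwc.ne, hwc.ne']
    · exact hs.ne f hf
  · intro f hf
    rcases List.mem_cons.1 hf with rfl | hf
    · omega
    · have := hs.bounds f hf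
      omega
  · rw [List.map_cons, List.nodup_cons]
    refine ⟨fun hm => ?_, hs.nodup⟩
    obtain ⟨f, hf, hfe⟩ := List.mem_map.1 hm
    have := hs.bounds f hf
    omega
  · intro x hx
    have hx' : x = w ∨ x = c ∨ x ∈ s.vars := by
      simp only [PhiShape.mem_vars, List.mem_cons, exists_or] at hx ⊢
      rcases he with rfl | rfl <;> simp only [Prod.mk.injEq, exists_and_left, exists_and_right,
        exists_eq, and_true, true_and] at hx <;> tauto
    rcases hx' with rfl | rfl | hx
    · rfl
    · exact hadj.reachable
    · exact hadj.reachable.trans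
        ((hs.reachable x hx).mono (shapeGraph_mono (List.subset_cons_self _ _)))

theorem eq_of_max_eq (hs : s.IsIncreasingTree w c d) {e f : Nat × Nat} (he : e ∈ s.rel)
    (hf : f ∈ s.rel) (h : max e.1 e.2 = max f.1 f.2) : e = f :=
  List.inj_on_of_nodup_map hs.nodup he hf h

theorem isAcyclic (hs : s.IsIncreasingTree w c d) : (shapeGraph s).IsAcyclic := by
  refine SimpleGraph.isAcyclic_of_unique_lt_adj fun u x y hx hy hxu hyu => ?_
  rw [shapeGraph_adj] at hx hy
  rcases hx.2 with hx | hx <;> rcases hy.2 with hy | hy <;>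
  · have := hs.eq_of_max_eq hx hy (by simp [hxu.le, hyu.le])
    simp only [Prod.mk.injEq] at this
    omega

end PhiShape.IsIncreasingTree

theorem SimpFm.isIncreasingTree_phiAux {A : Fm} (hA : SimpFm A) {w c : Nat} (hwc : w < c) :
    (phiAux A w c).1.IsIncreasingTree w c (phiAux A w c).2 := by
  induction hA generalizing w c with
  | atom p =>
    refine ⟨le_rfl, by simp [phiAux], by simp [phiAux], by simp [phiAux], fun x hx => ?_⟩
    obtain rfl : x = w := by simpa [phiAux, PhiShape.mem_vars] using hx
    rfl
  | top =>
    exact ⟨le_rfl, by simp [phiAux], by simp [phiAux], by simp [phiAux],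
      by simp [phiAux, PhiShape.mem_vars]⟩
  | and _ _ ihA ihB => exact (ihA hwc).comp (ihB (hwc.trans_le (ihA hwc).le))
  | dia _ ih => exact (ih (Nat.lt_succ_self c)).cons hwc (.inl rfl)
  | diaP _ ih => exact (ih (Nat.lt_succ_self c)).cons hwc (.inr rfl)

/-- If `A ∈ L_{∧,◇,♦}`, then the schematic labeled sequent `φ_ẇ(A)`
forms a polytree: its graph is connected and free of directed and undirected cycles. -/
theorem phi_forms_polytree (A : Fm) (hA : SimpFm A) (w c : Nat) (hwc : w < c) :
    ((phiAux A w c).1).rel.Nodup ∧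
    (∀ a, (a, a) ∉ ((phiAux A w c).1).rel) ∧
    (∀ a b, (a, b) ∈ ((phiAux A w c).1).rel → (b, a) ∉ ((phiAux A w c).1).rel) ∧
    (shapeGraph (phiAux A w c).1).IsAcyclic ∧
    (∀ a ∈ shapeVars (phiAux A w c).1, ∀ b ∈ shapeVars (phiAux A w c).1,
      (shapeGraph (phiAux A w c).1).Reachable a b) := by
  have h := hA.isIncreasingTree_phiAux hwc
  refine ⟨h.nodup.of_map _, fun a ha => h.ne _ ha rfl, fun a b hab hba => ?_, h.isAcyclic,
    fun a ha b hb => ?_⟩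
  · have := h.eq_of_max_eq hab hba (max_comm a b)
    exact h.ne _ hab (Prod.mk.inj this).1
  · exact (h.reachable a (List.mem_toFinset.1 ha)).symm.trans
      (h.reachable b (List.mem_toFinset.1 hb))
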